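/- Let T be a tree with n vertices and exactly r branching vertices (1 ≤ r ≤ n/2 − 1) such that ξ^{ce}(T) is minimum among all n-vertex trees with exactly r branching vertices. Then every vertex of T has degree at most 3; consequently the degree sequence of T is (3,…,3, 2,…,2, 1,…,1) with exactly r threes. -/

import Mathlib

open Finset SimpleGraph

variable {V : Type*}

open Classical in
/-- The degree of a vertex `u` in a graph `G` (number of neighbors). -/
noncomputable def deg [Fintype V] (G : SimpleGraph V) (u : V) : ℕ :=
  (Finset.univ.filter (fun v => G.Adj u v)).card

/-- The eccentricity of a vertex `u`: the maximum distance from `u` to any vertex. -/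
noncomputable def ecc [Fintype V] (G : SimpleGraph V) (u : V) : ℕ :=
  Finset.univ.sup (fun v => G.dist u v)

/-- The connective eccentricity index `ξ^{ce}(G) = Σ_{u ∈ V} d(u)/ε(u)`. -/
noncomputable def cei [Fintype V] (G : SimpleGraph V) : ℝ :=
  ∑ u : V, (deg G u : ℝ) / (ecc G u)

/-- The number of branching vertices (vertices of degree at least 3) of `T`. -/
noncomputable def branchCount [Fintype V] (T : SimpleGraph V) : ℕ :=
  (Finset.univ.filter (fun v => 3 ≤ deg T v)).card

namespace SimpleGraph

variable {G : SimpleGraph V}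

/-- A function changing by at most one along every edge bounds distances from below. -/
theorem Connected.sub_le_dist (hG : G.Connected) {f : V → ℤ}
    (hf : ∀ ⦃p q⦄, G.Adj p q → f p ≤ f q + 1) (a b : V) : f a - f b ≤ G.dist a b := by
  obtain ⟨p, hp⟩ := hG.exists_walk_length_eq_dist a b
  rw [← hp]
  clear hp
  induction p with
  | nil => simp
  | cons h p ih =>
    have := hf h
    rw [Walk.length_cons]
    push_cast
    linarith

theorem Connected.dist_le_dist_add_one (hG : G.Connected) {p q : V} (h : G.Adj p q) (z : V) :
    G.dist p z ≤ G.dist q z + 1 := by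
  have := hG.dist_triangle (u := p) (v := q) (w := z)
  rw [dist_eq_one_iff_adj.2 h] at this
  omega

theorem Connected.exists_adj_dist_add_one (hG : G.Connected) {u z : V} (h : u ≠ z) :
    ∃ a, G.Adj u a ∧ G.dist a z + 1 = G.dist u z := by
  obtain ⟨p, hp⟩ := hG.exists_walk_length_eq_dist u z
  cases p with
  | nil => exact absurd rfl h
  | cons hadj p =>
    refine ⟨_, hadj, ?_⟩
    have h1 := dist_le p
    have h2 := hG.dist_le_dist_add_one hadj z
    rw [Walk.length_cons] at hp
    omega

/-- In a tree, at most one neighbor of a vertex is closer to a given target. -/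
theorem IsTree.eq_of_adj_of_dist_lt (hG : G.IsTree) {u a b z : V} (ha : G.Adj u a)
    (hb : G.Adj u b) (haz : G.dist a z < G.dist u z) (hbz : G.dist b z < G.dist u z) : a = b := by
  have key : ∀ c, G.Adj u c → G.dist c z < G.dist u z →
      ∃ p : G.Walk u z, p.IsPath ∧ p.snd = c := by
    intro c hc hcz
    obtain ⟨p, hp⟩ := hG.connected.exists_walk_length_eq_dist c z
    refine ⟨.cons hc p, Walk.isPath_of_length_eq_dist _ ?_, by simp⟩
    have := hG.connected.dist_le_dist_add_one hc z
    rw [Walk.length_cons]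
    omega
  obtain ⟨p, hp, rfl⟩ := key a ha haz
  obtain ⟨q, hq, rfl⟩ := key b hb hbz
  rw [(hG.existsUnique_path u z).unique hp hq]

theorem IsTree.dist_eq_add_one_or (hG : G.IsTree) {v w : V} (h : G.Adj v w) (z : V) :
    G.dist v z = G.dist w z + 1 ∨ G.dist w z = G.dist v z + 1 := by
  simpa only [dist_comm] using hG.dist_eq_dist_add_one_of_adj z h

/-- The only edge of a tree joining the two sides of the edge `vw` is `vw` itself. -/
theorem IsTree.eq_of_adj_of_dist_lt_of_dist_lt (hG : G.IsTree) {v w p q : V} (hvw : G.Adj v w)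
    (hpq : G.Adj p q) (hp : G.dist p w < G.dist p v) (hq : ¬ G.dist q w < G.dist q v) :
    p = w ∧ q = v := by
  have h1 := hG.dist_eq_dist_add_one_of_adj p hvw
  have h2 := hG.dist_eq_dist_add_one_of_adj q hvw
  have h3 := hG.connected.dist_le_dist_add_one hpq v
  have h4 := hG.connected.dist_le_dist_add_one hpq.symm w
  by_cases hpw : p = w
  · subst hpw
    refine ⟨rfl, ?_⟩
    rw [dist_self] at *
    exact hG.connected.dist_eq_zero_iff.1 (by omega)
  · obtain ⟨a, ha, haw⟩ := hG.connected.exists_adj_dist_add_one hpw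
    have h5 : G.dist a v ≤ G.dist a w + 1 := by
      have := hG.dist_eq_dist_add_one_of_adj a hvw
      omega
    have : a = q := hG.eq_of_adj_of_dist_lt ha hpq (z := v) (by omega) (by omega)
    subst this
    omega

/-- A shortest path crossing the edge `vw` passes through `v`. -/
theorem IsTree.dist_eq_add_of_dist_lt (hG : G.IsTree) {v w s t : V} (hvw : G.Adj v w)
    (hs : ¬ G.dist s w < G.dist s v) (ht : G.dist t w < G.dist t v) :
    G.dist t s = G.dist t v + G.dist v s := by
  classical
  refine le_antisymm hG.connected.dist_triangle ?_
  have := hG.connected.sub_le_dist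
    (f := fun z => if G.dist z w < G.dist z v then (G.dist z v : ℤ) else -(G.dist z v : ℤ)) ?_ t s
  · rw [if_pos ht, if_neg hs] at this
    rw [G.dist_comm (u := v)]
    omega
  · intro p q hpq
    have h1 := hG.connected.dist_le_dist_add_one hpq v
    have h2 := hG.connected.dist_le_dist_add_one hpq.symm v
    split_ifs with hp hq hq
    · omega
    · obtain ⟨rfl, rfl⟩ := hG.eq_of_adj_of_dist_lt_of_dist_lt hvw hpq hp hq
      simp_all
    · omega
    · omega

/-- The two ends of a longest path realize all eccentricities of a tree. -/
theorem IsTree.dist_le_max_of_diametral (hG : G.IsTree) {x y : V}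
    (hxy : ∀ a b, G.dist a b ≤ G.dist x y) (u t : V) :
    G.dist u t ≤ max (G.dist u x) (G.dist u y) := by
  induction hk : G.dist u x + G.dist u y using Nat.strong_induction_on generalizing u with
  | _ k ih =>
  by_cases hux : u = x
  · subst hux
    exact le_max_of_le_right (hxy _ _)
  by_cases huy : u = y
  · subst huy
    exact le_max_of_le_left (by simpa only [G.dist_comm (u := x)] using hxy u t)
  by_cases hut : u = t
  · simp [hut]
  obtain ⟨a, ha, hax⟩ := hG.connected.exists_adj_dist_add_one hux
  obtain ⟨b, hb, hby⟩ := hG.connected.exists_adj_dist_add_one huy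
  by_cases hab : a = b
  · subst hab
    have h1 := ih _ (by omega) a rfl
    have h2 := hG.connected.dist_le_dist_add_one ha t
    omega
  obtain ⟨c, hc, hct⟩ := hG.connected.exists_adj_dist_add_one hut
  have hxyu : G.dist x y ≤ G.dist x u + G.dist u y := hG.connected.dist_triangle
  have key : ∀ s d, G.Adj u d → G.dist d s + 1 = G.dist u s → d ≠ c →
      G.dist t s = G.dist t u + G.dist u s := by
    intro s d hd hds hdc
    refine hG.dist_eq_add_of_dist_lt hc (fun h => hdc ?_) ?_
    · exact hG.eq_of_adj_of_dist_lt hd hc (z := s) (by omega)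
        (by simpa only [dist_comm] using h)
    · rw [G.dist_comm (v := c), G.dist_comm (v := u)]
      omega
  have htx := hxy t x
  have hty := hxy t y
  rw [G.dist_comm (u := u) (v := t)]
  rw [G.dist_comm (u := x) (v := u)] at hxyu
  by_cases hca : a = c
  · have := key y b hb hby (fun h => hab (hca.trans h.symm))
    omega
  · have := key x a ha hax hca
    omega

theorem IsTree.adj_unique_of_diametral (hG : G.IsTree) {x y a b : V}
    (hxy : ∀ a b, G.dist a b ≤ G.dist x y) (ha : G.Adj x a) (hb : G.Adj x b) : a = b := by
  have h1 := hG.dist_eq_add_one_or ha y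
  have h2 := hG.dist_eq_add_one_or hb y
  have h3 := hxy a y
  have h4 := hxy b y
  exact hG.eq_of_adj_of_dist_lt ha hb (z := y) (by omega) (by omega)

/-- The graph obtained from `G` by replacing the edge `vw` with the edge `xw`. -/
def reattach (G : SimpleGraph V) (v w x : V) : SimpleGraph V :=
  G.deleteEdges {s(v, w)} ⊔ edge x w

theorem reattach_adj {v w x p q : V} (hxw : x ≠ w) :
    (G.reattach v w x).Adj p q ↔ (G.Adj p q ∧ s(p, q) ≠ s(v, w)) ∨ s(p, q) = s(x, w) := by
  simp only [reattach, sup_adj, deleteEdges_adj, Set.mem_singleton_iff, edge_adj, Sym2.eq_iff]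
  grind

section Reattach

variable {v w x : V}

theorem IsTree.not_adj_of_dist (hG : G.IsTree) (hvw : G.Adj v w) (hxv : x ≠ v)
    (hx : ¬ G.dist x w < G.dist x v) : ¬ G.Adj w x := by
  intro h
  refine hxv (hG.eq_of_adj_of_dist_lt_of_dist_lt hvw h ?_ hx).2
  simpa using hG.connected.pos_dist_of_ne hvw.ne'

theorem ne_of_not_dist_lt (hG : G.IsTree) (hvw : G.Adj v w) (hx : ¬ G.dist x w < G.dist x v) :
    x ≠ w := by
  rintro rfl
  exact hx (by simpa using hG.connected.pos_dist_of_ne hvw.ne')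

theorem IsTree.reattach_connected (hG : G.IsTree) (hvw : G.Adj v w)
    (hx : ¬ G.dist x w < G.dist x v) : (G.reattach v w x).Connected := by
  have hxw := ne_of_not_dist_lt hG hvw hx
  have hwv : 0 < G.dist w v := hG.connected.pos_dist_of_ne hvw.ne'
  have hdx := hG.dist_eq_dist_add_one_of_adj x hvw
  have hside : ∀ z, G.dist z w < G.dist z v → (G.reattach v w x).Reachable z w := by
    intro z
    induction hk : G.dist z w using Nat.strong_induction_on generalizing z with
    | _ k ih =>
    intro hz
    by_cases hzw : z = w
    · rw [hzw]
    obtain ⟨a, ha, haw⟩ := hG.connected.exists_adj_dist_add_one hzw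
    have hav := hG.connected.dist_le_dist_add_one ha v
    refine Adj.reachable ((reattach_adj hxw).2 (Or.inl ⟨ha, ?_⟩)) |>.trans
      (ih _ (by omega) a rfl (by omega))
    intro h
    rcases Sym2.eq_iff.1 h with ⟨rfl, rfl⟩ | ⟨rfl, rfl⟩
    · simp at hz
    · exact hzw rfl
  have hother : ∀ z, (G.reattach v w x).Reachable z x := by
    intro z
    induction hk : G.dist z x using Nat.strong_induction_on generalizing z with
    | _ k ih =>
    by_cases hzx : z = x
    · rw [hzx]
    by_cases hz : G.dist z w < G.dist z v
    · exact (hside z hz).trans (Adj.reachable ((reattach_adj hxw).2 (Or.inr Sym2.eq_swap)))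
    obtain ⟨a, ha, hax⟩ := hG.connected.exists_adj_dist_add_one hzx
    refine Adj.reachable ((reattach_adj hxw).2 (Or.inl ⟨ha, ?_⟩)) |>.trans
      (ih _ (by omega) a rfl)
    intro h
    rcases Sym2.eq_iff.1 h with ⟨rfl, rfl⟩ | ⟨rfl, rfl⟩
    · rw [G.dist_comm (u := x), G.dist_comm (u := x)] at hdx hx
      omega
    · rw [dist_self] at hz
      omega
  have := hG.connected.nonempty
  exact ⟨fun a b => (hother a).trans (hother b).symm⟩

theorem IsTree.reattach_isTree [Finite V] (hG : G.IsTree) (hvw : G.Adj v w) (hxv : x ≠ v)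
    (hx : ¬ G.dist x w < G.dist x v) : (G.reattach v w x).IsTree := by
  have hxw := ne_of_not_dist_lt hG hvw hx
  refine isTree_iff_connected_and_card.2 ⟨hG.reattach_connected hvw hx, ?_⟩
  rw [← (isTree_iff_connected_and_card.1 hG).2]
  have hset : (G.reattach v w x).edgeSet = insert s(x, w) (G.edgeSet \ {s(v, w)}) := by
    ext e
    induction e with
    | _ p q =>
    rw [mem_edgeSet, reattach_adj hxw, Set.mem_insert_iff, Set.mem_sdiff, mem_edgeSet,
      Set.mem_singleton_iff, or_comm]
  have hnot : s(x, w) ∉ G.edgeSet \ {s(v, w)} := fun h =>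
    hG.not_adj_of_dist hvw hxv hx (G.adj_symm h.1)
  have hmem : s(v, w) ∈ G.edgeSet := hvw
  rw [Nat.card_coe_set_eq, Nat.card_coe_set_eq, hset,
    Set.ncard_insert_of_notMem hnot (Set.toFinite _), Set.ncard_sdiff_singleton_add_one hmem]

/-- Lower bound for distances after reattaching, in terms of a function on the part containing
`v` and a function on the part containing `w`. -/
theorem IsTree.sub_le_dist_reattach (hG : G.IsTree) (hvw : G.Adj v w)
    (hx : ¬ G.dist x w < G.dist x v) {f : V → ℤ}
    (hf : ∀ ⦃p q⦄, G.Adj p q → (G.dist p w < G.dist p v ↔ G.dist q w < G.dist q v) →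
      f p ≤ f q + 1)
    (hxw : |f x - f w| ≤ 1) (a b : V) : f a - f b ≤ (G.reattach v w x).dist a b := by
  rw [abs_le] at hxw
  refine (hG.reattach_connected hvw hx).sub_le_dist (fun p q hpq => ?_) a b
  rcases (reattach_adj (ne_of_not_dist_lt hG hvw hx)).1 hpq with ⟨h, hne⟩ | h
  · refine hf h ?_
    by_contra hside
    by_cases hp : G.dist p w < G.dist p v
    · obtain ⟨rfl, rfl⟩ := hG.eq_of_adj_of_dist_lt_of_dist_lt hvw h hp (by tauto)
      exact hne Sym2.eq_swap
    · obtain ⟨rfl, rfl⟩ := hG.eq_of_adj_of_dist_lt_of_dist_lt hvw h.symm (by tauto) hp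
      exact hne rfl
  · rcases Sym2.eq_iff.1 h with ⟨rfl, rfl⟩ | ⟨rfl, rfl⟩ <;> linarith

theorem IsTree.dist_le_dist_reattach_target (hG : G.IsTree) (hvw : G.Adj v w)
    (hx : ¬ G.dist x w < G.dist x v) {u : V} (hu : ¬ G.dist u w < G.dist u v) :
    G.dist u x ≤ (G.reattach v w x).dist u x := by
  classical
  have := hG.sub_le_dist_reattach hvw hx
    (f := fun z => if G.dist z w < G.dist z v then 0 else (G.dist z x : ℤ)) ?_ ?_ u x
  · rw [if_neg hu, if_neg hx, dist_self] at this
    omega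
  · intro p q hpq hside
    have := hG.connected.dist_le_dist_add_one hpq x
    by_cases hp : G.dist p w < G.dist p v
    · simp [hp, hside.1 hp]
    · rw [if_neg hp, if_neg (fun h => hp (hside.2 h))]
      omega
  · have hw : G.dist w w < G.dist w v := by simpa using hG.connected.pos_dist_of_ne hvw.ne'
    rw [if_neg hx, if_pos hw, dist_self]
    simp

theorem IsTree.dist_reattach_bounds (hG : G.IsTree) (hvw : G.Adj v w)
    (hx : ¬ G.dist x w < G.dist x v) {y : V} (hy : ¬ G.dist y w < G.dist y v) (u : V) :
    (¬ G.dist u w < G.dist u v → G.dist u y ≤ (G.reattach v w x).dist u y) ∧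
    (G.dist u w < G.dist u v →
      G.dist u w + 1 + G.dist x y ≤ (G.reattach v w x).dist u y) := by
  classical
  have := hG.sub_le_dist_reattach hvw hx
    (f := fun z => if G.dist z w < G.dist z v then (G.dist z w + 1 + G.dist x y : ℤ)
      else (G.dist z y : ℤ)) ?_ ?_ u y
  · rw [if_neg hy, dist_self] at this
    constructor
    · intro hu
      rw [if_neg hu] at this
      omega
    · intro hu
      rw [if_pos hu] at this
      omega
  · intro p q hpq hside
    have h1 := hG.connected.dist_le_dist_add_one hpq y
    have h2 := hG.connected.dist_le_dist_add_one hpq w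
    by_cases hp : G.dist p w < G.dist p v
    · rw [if_pos hp, if_pos (hside.1 hp)]
      omega
    · rw [if_neg hp, if_neg (fun h => hp (hside.2 h))]
      omega
  · have : G.dist w w < G.dist w v := by simpa using hG.connected.pos_dist_of_ne hvw.ne'
    rw [if_neg hx, if_pos this, dist_self, abs_le]
    constructor <;> push_cast <;> linarith

theorem dist_le_ecc [Fintype V] (H : SimpleGraph V) (a b : V) : H.dist a b ≤ ecc H a :=
  Finset.le_sup (f := fun v => H.dist a v) (Finset.mem_univ b)

theorem ecc_le [Fintype V] {H : SimpleGraph V} {a : V} {k : ℕ} (h : ∀ b, H.dist a b ≤ k) :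
    ecc H a ≤ k :=
  Finset.sup_le fun b _ => h b

theorem IsTree.ecc_le_ecc_reattach [Fintype V] (hG : G.IsTree) (hvw : G.Adj v w) {y : V}
    (hxy : ∀ a b, G.dist a b ≤ G.dist x y) (hx : ¬ G.dist x w < G.dist x v)
    (hy : ¬ G.dist y w < G.dist y v) (u : V) : ecc G u ≤ ecc (G.reattach v w x) u := by
  refine ecc_le fun t => ?_
  have hb := hG.dist_reattach_bounds hvw hx hy u
  have hey := dist_le_ecc (G.reattach v w x) u y
  by_cases hu : G.dist u w < G.dist u v
  · have := hb.2 hu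
    have := hxy u t
    omega
  · have h1 := hb.1 hu
    have h2 := hG.dist_le_dist_reattach_target hvw hx hu
    have h3 := dist_le_ecc (G.reattach v w x) u x
    have h4 := hG.dist_le_max_of_diametral hxy u t
    omega

theorem IsTree.dist_lt_ecc_reattach [Fintype V] (hG : G.IsTree) (hvw : G.Adj v w) {y : V}
    (hx : ¬ G.dist x w < G.dist x v) (hy : ¬ G.dist y w < G.dist y v) :
    G.dist x y < ecc (G.reattach v w x) y := by
  have hw : G.dist w w < G.dist w v := by simpa using hG.connected.pos_dist_of_ne hvw.ne'
  have h1 := (hG.dist_reattach_bounds hvw hx hy w).2 hw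
  have h2 := dist_le_ecc (G.reattach v w x) y w
  rw [dist_comm] at h2
  omega

theorem deg_reattach_add_one [Fintype V] (hvw : G.Adj v w) (hxw : x ≠ w) (hxv : x ≠ v) :
    deg (G.reattach v w x) v + 1 = deg G v := by
  classical
  rw [deg, deg, ← Finset.card_erase_add_one (s := Finset.univ.filter (fun z => G.Adj v z))
    (a := w) (by simpa using hvw)]
  congr 2
  ext z
  simp only [Finset.mem_filter, Finset.mem_univ, true_and, Finset.mem_erase, reattach_adj hxw,
    ne_eq, Sym2.eq_iff]
  grind [hvw.ne]

theorem deg_reattach_target [Fintype V] (hxw : x ≠ w) (hxv : x ≠ v) (hadj : ¬ G.Adj w x) :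
    deg (G.reattach v w x) x = deg G x + 1 := by
  classical
  rw [deg, deg, ← Finset.card_insert_of_notMem (a := w) (by simpa [G.adj_comm] using hadj)]
  congr 1
  ext z
  simp only [Finset.mem_filter, Finset.mem_univ, true_and, Finset.mem_insert, reattach_adj hxw,
    ne_eq, Sym2.eq_iff]
  grind

theorem deg_reattach_of_ne [Fintype V] (hvw : G.Adj v w) (hxw : x ≠ w) (hadj : ¬ G.Adj w x)
    {u : V} (huv : u ≠ v) (hux : u ≠ x) : deg (G.reattach v w x) u = deg G u := by
  classical
  by_cases huw : u = w
  · subst huw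
    rw [deg, deg, ← Finset.card_erase_add_one (s := Finset.univ.filter (fun z => G.Adj u z))
      (a := v) (by simpa using hvw.symm), ← Finset.card_insert_of_notMem (a := x)
      (by simp [hadj])]
    congr 1
    ext z
    simp only [Finset.mem_filter, Finset.mem_univ, true_and, Finset.mem_insert,
      Finset.mem_erase, reattach_adj hxw, ne_eq, Sym2.eq_iff]
    grind
  · rw [deg, deg]
    congr 1
    ext z
    simp only [Finset.mem_filter, Finset.mem_univ, true_and, reattach_adj hxw, ne_eq, Sym2.eq_iff]
    grind

end Reattach

end SimpleGraph

theorem SimpleGraph.Iso.dist_eq {W : Type*} {G : SimpleGraph V} {H : SimpleGraph W} (φ : G ≃g H)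
    (hG : G.Connected) (a b : V) : H.dist (φ a) (φ b) = G.dist a b := by
  have hH : H.Connected := φ.connected_iff.1 hG
  apply le_antisymm
  · obtain ⟨p, hp⟩ := hG.exists_walk_length_eq_dist a b
    rw [← hp]
    exact (dist_le (p.map φ.toHom)).trans_eq (p.length_map _)
  · obtain ⟨p, hp⟩ := hH.exists_walk_length_eq_dist (φ a) (φ b)
    rw [← hp]
    simpa using dist_le (p.map φ.symm.toHom)

section Iso

variable {W : Type*} [Fintype V] [Fintype W] {G : SimpleGraph V} {H : SimpleGraph W}

theorem deg_iso (φ : G ≃g H) (u : V) : deg H (φ u) = deg G u := by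
  classical
  refine (Finset.card_equiv φ.toEquiv fun z => ?_).symm
  simpa using φ.map_adj_iff.symm

theorem ecc_iso (φ : G ≃g H) (hG : G.Connected) (u : V) : ecc H (φ u) = ecc G u := by
  apply le_antisymm
  · refine ecc_le fun z => ?_
    obtain ⟨z, rfl⟩ := φ.surjective z
    rw [φ.dist_eq hG]
    exact dist_le_ecc G u z
  · refine ecc_le fun z => ?_
    rw [← φ.dist_eq hG]
    exact dist_le_ecc H _ _

theorem cei_iso (φ : G ≃g H) (hG : G.Connected) : cei H = cei G := by
  refine (Fintype.sum_equiv φ.toEquiv _ _ fun u => ?_).symm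
  simp [deg_iso φ, ecc_iso φ hG]

theorem branchCount_iso (φ : G ≃g H) : branchCount H = branchCount G := by
  refine (Finset.card_equiv φ.toEquiv fun z => ?_).symm
  simp [deg_iso φ]

end Iso

section Tree

variable [Fintype V] {T : SimpleGraph V}

theorem deg_pos [Nontrivial V] (hT : T.Connected) (u : V) : 0 < deg T u := by
  classical
  obtain ⟨z, hz⟩ := exists_ne u
  obtain ⟨a, ha, -⟩ := hT.exists_adj_dist_add_one hz.symm
  exact Finset.card_pos.2 ⟨a, by simpa using ha⟩

theorem ecc_pos [Nontrivial V] (hT : T.Connected) (u : V) : 0 < ecc T u := by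
  obtain ⟨z, hz⟩ := exists_ne u
  exact (hT.pos_dist_of_ne hz.symm).trans_le (dist_le_ecc T u z)

theorem exists_diametral [Nonempty V] (T : SimpleGraph V) :
    ∃ x y, ∀ a b, T.dist a b ≤ T.dist x y := by
  obtain ⟨⟨x, y⟩, h⟩ := Finite.exists_max fun p : V × V => T.dist p.1 p.2
  exact ⟨x, y, fun a b => h (a, b)⟩

theorem deg_eq_one_of_diametral [Nontrivial V] (hT : T.IsTree) {x y : V}
    (hxy : ∀ a b, T.dist a b ≤ T.dist x y) : deg T x = 1 := by
  classical
  refine le_antisymm (Finset.card_le_one.2 fun a ha b hb => ?_) (deg_pos hT.connected x)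
  simp only [Finset.mem_filter, Finset.mem_univ, true_and] at ha hb
  exact hT.adj_unique_of_diametral hxy ha hb

/-- A vertex of degree at least three has a neighbor off the paths to two given vertices. -/
theorem exists_adj_not_dist_lt (hT : T.IsTree) {v : V} (hv : 3 ≤ deg T v) (x y : V) :
    ∃ w, T.Adj v w ∧ ¬ T.dist x w < T.dist x v ∧ ¬ T.dist y w < T.dist y v := by
  classical
  by_contra! hcon
  have hone : ∀ z, #{w | T.Adj v w ∧ T.dist z w < T.dist z v} ≤ 1 := by
    intro z
    refine Finset.card_le_one.2 fun a ha b hb => ?_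
    simp only [Finset.mem_filter, Finset.mem_univ, true_and] at ha hb
    refine hT.eq_of_adj_of_dist_lt ha.1 hb.1 (z := z) ?_ ?_
    · simpa only [dist_comm] using ha.2
    · simpa only [dist_comm] using hb.2
  have hsub : Finset.univ.filter (fun w => T.Adj v w) ⊆
      ({w | T.Adj v w ∧ T.dist x w < T.dist x v} : Finset V) ∪
        ({w | T.Adj v w ∧ T.dist y w < T.dist y v} : Finset V) := by
    intro w hw
    simp only [Finset.mem_filter, Finset.mem_univ, true_and, Finset.mem_union] at hw ⊢
    have := hcon w hw
    grind
  have h1 := (Finset.card_le_card hsub).trans (Finset.card_union_le _ _)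
  have h2 := hone x
  have h3 := hone y
  have h4 : deg T v = #{w | T.Adj v w} := rfl
  omega

/-- A tree with a vertex of degree at least four does not minimize the connective eccentricity
index among the trees with the same number of branching vertices. -/
theorem exists_isTree_branchCount_eq_cei_lt (hT : T.IsTree) {v : V} (hv : 4 ≤ deg T v) :
    ∃ T' : SimpleGraph V, T'.IsTree ∧ branchCount T' = branchCount T ∧ cei T' < cei T := by
  classical
  have : Nontrivial V := by
    have hpos : 0 < deg T v := by omega
    obtain ⟨w, hw⟩ := Finset.card_pos.1 hpos
    exact ⟨v, w, (by simpa using hw : T.Adj v w).ne⟩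
  obtain ⟨x, y, hxy⟩ := exists_diametral T
  obtain ⟨w, hvw, hx, hy⟩ := exists_adj_not_dist_lt hT (by omega : 3 ≤ deg T v) x y
  have hdx := deg_eq_one_of_diametral hT hxy
  have hxv : x ≠ v := by
    rintro rfl
    omega
  have hxw := ne_of_not_dist_lt hT hvw hx
  have hadj := hT.not_adj_of_dist hvw hxv hx
  have hT' := hT.reattach_isTree hvw hxv hx
  have hdegv := deg_reattach_add_one hvw hxw hxv
  have hdegx := deg_reattach_target (v := v) hxw hxv hadj
  have hdeg : ∀ u, u ≠ v → u ≠ x → deg (T.reattach v w x) u = deg T u := fun u =>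
    deg_reattach_of_ne hvw hxw hadj
  refine ⟨T.reattach v w x, hT', ?_, ?_⟩
  · refine congrArg Finset.card (Finset.filter_congr fun u _ => ?_)
    by_cases huv : u = v
    · subst huv
      omega
    by_cases hux : u = x
    · subst hux
      omega
    rw [hdeg u huv hux]
  · have hpos : ∀ u, (0 : ℝ) < ecc T u := fun u => by exact_mod_cast ecc_pos hT.connected u
    have hle : ∀ u, (ecc T u : ℝ) ≤ ecc (T.reattach v w x) u := fun u => by
      exact_mod_cast hT.ecc_le_ecc_reattach hvw hxy hx hy u
    have hlt : (ecc T y : ℝ) < ecc (T.reattach v w x) y := by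
      exact_mod_cast (ecc_le (hxy y)).trans_lt (hT.dist_lt_ecc_reattach hvw hx hy)
    calc cei (T.reattach v w x)
        < ∑ u, (deg (T.reattach v w x) u : ℝ) / ecc T u := by
          refine Finset.sum_lt_sum (fun u _ => ?_) ⟨y, Finset.mem_univ y, ?_⟩
          · exact div_le_div_of_nonneg_left (Nat.cast_nonneg _) (hpos u) (hle u)
          · exact div_lt_div_of_pos_left (by exact_mod_cast deg_pos hT'.connected y) (hpos y) hlt
      _ = ∑ u, ((deg T u : ℝ) / ecc T u + (if u = x then 1 / (ecc T x : ℝ) else 0)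
            - (if u = v then 1 / (ecc T v : ℝ) else 0)) := by
          refine Finset.sum_congr rfl fun u _ => ?_
          by_cases huv : u = v
          · subst huv
            rw [if_neg hxv.symm, if_pos rfl, ← hdegv]
            push_cast
            ring
          by_cases hux : u = x
          · subst hux
            rw [if_neg huv, if_pos rfl, hdegx]
            push_cast
            ring
          rw [if_neg huv, if_neg hux, hdeg u huv hux]
          ring
      _ = cei T + 1 / ecc T x - 1 / ecc T v := by
          rw [Finset.sum_sub_distrib, Finset.sum_add_distrib]
          simp [cei]
      _ ≤ cei T := by
          have h : (ecc T v : ℝ) ≤ ecc T x := by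
            exact_mod_cast (ecc_le (hxy v)).trans (dist_le_ecc T x y)
          have := one_div_le_one_div_of_le (hpos v) h
          linarith

theorem sum_deg (hT : T.IsTree) : ∑ u, deg T u + 2 = 2 * Fintype.card V := by
  classical
  have h1 := T.sum_degrees_eq_twice_card_edges
  have h2 := hT.card_edgeFinset
  have h3 : ∀ u, deg T u = T.degree u := fun u => by
    rw [deg, ← card_neighborFinset_eq_degree, neighborFinset_eq_filter]
  simp only [h3, h1]
  omega

/-- The degree sequence of a tree of maximum degree at most three. -/
theorem map_deg_of_deg_le_three [Nontrivial V] (hT : T.IsTree) (h3 : ∀ v, deg T v ≤ 3) :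
    Finset.univ.val.map (deg T) =
      Multiset.replicate (branchCount T) 3 +
        Multiset.replicate (Fintype.card V - 2 * branchCount T - 2) 2 +
          Multiset.replicate (branchCount T + 2) 1 := by
  classical
  have hcount : ∀ k, (Finset.univ.val.map (deg T)).count k = #{u | deg T u = k} := fun k => by
    rw [Multiset.count_map]
    simp only [eq_comm]
    rfl
  have hdeg : ∀ u, deg T u ∈ Finset.Icc 1 3 := fun u =>
    Finset.mem_Icc.2 ⟨deg_pos hT.connected u, h3 u⟩
  have hcard := Finset.card_eq_sum_card_fiberwise (s := (Finset.univ : Finset V)) (f := deg T)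
    (t := Finset.Icc 1 3) fun u _ => hdeg u
  have hsum := Finset.sum_fiberwise_of_maps_to (s := (Finset.univ : Finset V)) (g := deg T)
    (t := Finset.Icc 1 3) (fun u _ => hdeg u) (deg T)
  have hsum' : ∀ k, ∑ u with deg T u = k, deg T u = k * #{u | deg T u = k} := fun k => by
    rw [Finset.sum_congr rfl fun u hu => (Finset.mem_filter.1 hu).2, Finset.sum_const,
      smul_eq_mul, mul_comm]
  have hIcc : Finset.Icc 1 3 = {1, 2, 3} := rfl
  have htot := sum_deg hT
  have hbr : branchCount T = #{u | deg T u = 3} := by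
    refine congrArg Finset.card (Finset.filter_congr fun u _ => ?_)
    have := h3 u
    omega
  simp only [hsum', hIcc] at hsum hcard
  simp only [Finset.mem_insert, Finset.mem_singleton, OfNat.one_ne_ofNat, Nat.reduceEqDiff,
    or_self, not_false_eq_true, Finset.sum_insert, Finset.sum_singleton, Finset.card_univ]
    at hsum hcard
  ext k
  rw [hcount, Multiset.count_add, Multiset.count_add, Multiset.count_replicate,
    Multiset.count_replicate, Multiset.count_replicate]
  by_cases hk : k ∈ Finset.Icc 1 3
  · rw [Finset.mem_Icc] at hk
    obtain ⟨hk1, hk3⟩ := hk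
    interval_cases k <;> simp <;> omega
  · have hzero : #{u | deg T u = k} = 0 :=
      Finset.card_eq_zero.2 (Finset.filter_eq_empty_iff.2 fun u _ h => hk (h ▸ hdeg u))
    rw [Finset.mem_Icc] at hk
    rw [hzero, if_neg (by omega), if_neg (by omega), if_neg (by omega)]

end Tree

/-- a tree `T` on `n` vertices with exactly `r` branching vertices
(`1 ≤ r ≤ n/2 - 1`) minimizing the connective eccentricity index among all such
trees has maximum degree at most `3`; consequently its degree sequence is
`(3,…,3, 2,…,2, 1,…,1)` with exactly `r` threes, `n - 2r - 2` twos and `r + 2` ones. -/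
theorem maxDegree_le_three_of_cei_min {n r : ℕ} (hr : 1 ≤ r) (hrn : 2 * r + 2 ≤ n)
    [Fintype V] (hcard : Fintype.card V = n)
    (T : SimpleGraph V) (hT : T.IsTree) (hbr : branchCount T = r)
    (hmin : ∀ T' : SimpleGraph (Fin n), T'.IsTree → branchCount T' = r →
      cei T ≤ cei T') :
    (∀ v, deg T v ≤ 3) ∧
      Finset.univ.val.map (deg T) =
        Multiset.replicate r 3 + Multiset.replicate (n - 2 * r - 2) 2 +
          Multiset.replicate (r + 2) 1 := by
  have : Nontrivial V := Fintype.one_lt_card_iff_nontrivial.1 (by omega)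
  have h3 : ∀ v, deg T v ≤ 3 := by
    by_contra! ⟨v, hv⟩
    obtain ⟨T', hT', hbr', hlt⟩ := exists_isTree_branchCount_eq_cei_lt hT hv
    let φ := Iso.map (Fintype.equivFinOfCardEq hcard) T'
    have hle := hmin _ (φ.isTree_iff.1 hT') ((branchCount_iso φ).trans (hbr'.trans hbr))
    rw [cei_iso φ hT'.connected] at hle
    exact hle.not_gt hlt
  refine ⟨h3, ?_⟩
  rw [← hbr, ← hcard]
  exact map_deg_of_deg_le_three hT h3
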